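/- Under the same iteration as in the previous setting (x_{k+1} = γ s_k + (1−γ) x_k with s_k ∈ X, θ_{k+1} = θ_k − α ∇_θ g(x_{k+1}, θ_k) with α = 2/(μ_g + L_g), and y_k = P_Y( y_{k−1} + σ(∇_yΦ(x_k, θ_k, y_{k−1}) − μ(y_{k−1} − y_0)) ) with σ = 2/(L^Φ_{yy} + 2μ)), for every integer K ≥ 1, ∑_{k=0}^{K−1} ‖y_k − y*_μ(x_k)‖ ‖s_k − x_k‖ ≤ Γ_1 + Γ_2 ∑_{k=0}^{K−1} ‖s_k − x_k‖², where Γ_1 := ‖y_0 − y*_μ(x_0)‖ D_X/(1−ρ_D) + σ L^Φ_{yθ} β D_X ‖θ_0 − θ*(x_0)‖/((1−ρ_D)(1−β)) and Γ_2 := γ L_{yμ}/(μ(1−ρ_D)) + σ γ β L^Φ_{yθ} L_θ/((1−β)(1−ρ_D)), with ρ_D := L^Φ_{yy}/(L^Φ_{yy} + 2μ), β := (L_g − μ_g)/(L_g + μ_g), L_θ := C^g_{θx}/μ_g, L_{yμ} := L^Φ_{yx} + L_θ L^Φ_{yθ}. -/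

import Mathlib

open scoped RealInnerProductSpace

abbrev En (k : ℕ) : Type := EuclideanSpace ℝ (Fin k)

section ConvexAnalysis

variable {E : Type*} [NormedAddCommGroup E] [InnerProductSpace ℝ E]

theorem norm_sub_le_of_inner_sub_le_zero {z w p q : E} (hp : ⟪z - p, q - p⟫ ≤ 0)
    (hq : ⟪w - q, p - q⟫ ≤ 0) : ‖p - q‖ ≤ ‖z - w‖ := by
  have h : ‖p - q‖ * ‖p - q‖ ≤ ‖z - w‖ * ‖p - q‖ := by
    refine le_trans ?_ (real_inner_le_norm (z - w) (p - q))
    have h₁ : ⟪z - p, q - p⟫ = -⟪z - p, p - q⟫ := by rw [← inner_neg_right, neg_sub]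
    have h₂ : ⟪z - w, p - q⟫ = ⟪z - p, p - q⟫ - ⟪w - q, p - q⟫ + ⟪p - q, p - q⟫ := by
      rw [← inner_sub_left, ← inner_add_left]
      congr 1
      abel
    rw [← real_inner_self_eq_norm_mul_norm]
    linarith
  rcases (norm_nonneg (p - q)).eq_or_lt with h0 | h0
  · rw [← h0]
    exact norm_nonneg _
  · exact le_of_mul_le_mul_right h h0

theorem mul_norm_le_of_mul_norm_sq_le_inner {a u : E} {m C : ℝ} (hC : ‖a‖ ≤ C)
    (h : m * ‖u‖ ^ 2 ≤ ⟪a, u⟫) : m * ‖u‖ ≤ C := by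
  rcases (norm_nonneg u).eq_or_lt with h0 | h0
  · rw [← h0, mul_zero]
    exact (norm_nonneg a).trans hC
  · refine le_of_mul_le_mul_right ?_ h0
    calc m * ‖u‖ * ‖u‖ = m * ‖u‖ ^ 2 := by ring
      _ ≤ ‖a‖ * ‖u‖ := h.trans (real_inner_le_norm a u)
      _ ≤ C * ‖u‖ := by gcongr

theorem StrongConvexOn.convexOn_sub_sq {f : E → ℝ} {μ : ℝ} (hc : StrongConvexOn Set.univ μ f) :
    ConvexOn ℝ Set.univ fun z => f z - μ / 2 * ‖z - 0‖ ^ 2 := by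
  simpa using strongConvexOn_iff_convex.1 hc

variable [CompleteSpace E]

theorem HasGradientAt.sub_half_mul_norm_sub_sq {f : E → ℝ} {f' x : E} (hf : HasGradientAt f f' x)
    (c : ℝ) (a : E) :
    HasGradientAt (fun z => f z - c / 2 * ‖z - a‖ ^ 2) (f' - c • (x - a)) x := by
  rw [hasGradientAt_iff_hasFDerivAt] at hf ⊢
  refine (hf.fun_sub (((hasFDerivAt_id x).sub_const a).norm_sq.const_mul (c / 2))).congr_fderiv ?_
  ext v
  simp
  ring

theorem HasGradientAt.hasDerivAt_comp_line {f : E → ℝ} {G : E → E}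
    (hf : ∀ x, HasGradientAt f (G x) x) (x v : E) (t : ℝ) :
    HasDerivAt (fun t : ℝ => f (x + t • v)) ⟪G (x + t • v), v⟫ t := by
  have h := (hasGradientAt_iff_hasFDerivAt.1 (hf (x + t • v))).comp_hasDerivAt t
    (((hasDerivAt_id t).smul_const v).const_add x)
  simpa [Function.comp_def] using h

theorem ConvexOn.add_inner_gradient_le {f : E → ℝ} {G : E → E} (hc : ConvexOn ℝ Set.univ f)
    (hf : ∀ x, HasGradientAt f (G x) x) (x y : E) : f x + ⟪G x, y - x⟫ ≤ f y := by
  have hline : ConvexOn ℝ Set.univ (fun t : ℝ => f (x + t • (y - x))) := by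
    have h := hc.comp_affineMap (AffineMap.lineMap x y : ℝ →ᵃ[ℝ] E)
    simpa [Function.comp_def, AffineMap.lineMap_apply, add_comm] using h
  have h := hline.le_slope_of_hasDerivAt (Set.mem_univ 0) (Set.mem_univ 1) one_pos
    (HasGradientAt.hasDerivAt_comp_line hf x (y - x) 0)
  simp [slope] at h
  linarith

theorem ConvexOn.inner_gradient_sub_nonneg {f : E → ℝ} {G : E → E} (hc : ConvexOn ℝ Set.univ f)
    (hf : ∀ x, HasGradientAt f (G x) x) (x y : E) : 0 ≤ ⟪G x - G y, x - y⟫ := by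
  have h₁ := hc.add_inner_gradient_le hf x y
  have h₂ := hc.add_inner_gradient_le hf y x
  rw [← neg_sub x y, inner_neg_right] at h₁
  rw [inner_sub_left]
  linarith

/-- The descent lemma, under a one-sided Lipschitz bound on the gradient. -/
theorem le_add_inner_gradient_add_sq {f : E → ℝ} {G : E → E} {L : ℝ}
    (hf : ∀ x, HasGradientAt f (G x) x) (hL : ∀ x y, ⟪G x - G y, x - y⟫ ≤ L * ‖x - y‖ ^ 2)
    (x y : E) : f y ≤ f x + ⟪G x, y - x⟫ + L / 2 * ‖y - x‖ ^ 2 := by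
  set v := y - x with hv
  have hd : ∀ t : ℝ, HasDerivAt
      (fun t : ℝ => f (x + t • v) - t * ⟪G x, v⟫ - L / 2 * ‖v‖ ^ 2 * t ^ 2)
      (⟪G (x + t • v), v⟫ - ⟪G x, v⟫ - L * ‖v‖ ^ 2 * t) t := by
    intro t
    refine (((HasGradientAt.hasDerivAt_comp_line hf x v t).fun_sub
      ((hasDerivAt_id t).mul_const ⟪G x, v⟫)).fun_sub
      ((hasDerivAt_pow 2 t).const_mul (L / 2 * ‖v‖ ^ 2))).congr_deriv ?_
    simp
    ring
  have hanti := antitoneOn_of_deriv_nonpos (convex_Ici (0 : ℝ))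
    (fun t _ => (hd t).continuousAt.continuousWithinAt)
    (fun t _ => (hd t).differentiableAt.differentiableWithinAt)
    (fun t ht => by
      rw [interior_Ici, Set.mem_Ioi] at ht
      rw [(hd t).deriv]
      have h := hL (x + t • v) x
      rw [add_sub_cancel_left, inner_smul_right, norm_smul, inner_sub_left, mul_pow,
        Real.norm_eq_abs, sq_abs] at h
      have h' : t * (⟪G (x + t • v), v⟫ - ⟪G x, v⟫ - L * ‖v‖ ^ 2 * t) ≤ 0 := by linarith
      exact nonpos_of_mul_nonpos_right h' ht)
  have h := hanti (Set.mem_Ici.2 le_rfl) (Set.mem_Ici.2 zero_le_one) zero_le_one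
  simp [hv] at h
  linarith

/-- The Baillon–Haddad inequality: the gradient of a smooth convex function is cocoercive. -/
theorem ConvexOn.norm_gradient_sub_sq_le {f : E → ℝ} {G : E → E} {L : ℝ} (hL0 : 0 ≤ L)
    (hc : ConvexOn ℝ Set.univ f) (hf : ∀ x, HasGradientAt f (G x) x)
    (hL : ∀ x y, ⟪G x - G y, x - y⟫ ≤ L * ‖x - y‖ ^ 2) (x y : E) :
    ‖G x - G y‖ ^ 2 ≤ L * ⟪G x - G y, x - y⟫ := by
  have hstep : ∀ (τ : ℝ) (x y : E), (τ - L / 2 * τ ^ 2) * ‖G x - G y‖ ^ 2 ≤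
      f y - f x - ⟪G x, y - x⟫ := by
    intro τ x y
    have h₁ := hc.add_inner_gradient_le hf x (y + τ • (G x - G y))
    have h₂ := le_add_inner_gradient_add_sq hf hL y (y + τ • (G x - G y))
    rw [add_sub_cancel_left, inner_smul_right, norm_smul, mul_pow, Real.norm_eq_abs, sq_abs] at h₂
    rw [add_sub_right_comm, inner_add_right, inner_smul_right] at h₁
    have h₃ : ⟪G x, G x - G y⟫ - ⟪G y, G x - G y⟫ = ‖G x - G y‖ ^ 2 := by
      rw [← inner_sub_left, real_inner_self_eq_norm_sq]
    linear_combination h₁ + h₂ - τ * h₃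
  have hsum : ∀ τ : ℝ, (2 * τ - L * τ ^ 2) * ‖G x - G y‖ ^ 2 ≤ ⟪G x - G y, x - y⟫ := by
    intro τ
    have h₁ := hstep τ x y
    have h₂ := hstep τ y x
    rw [norm_sub_rev] at h₂
    rw [← neg_sub x y, inner_neg_right] at h₁
    rw [inner_sub_left]
    linarith
  rcases hL0.eq_or_lt with rfl | hpos
  · have h₀ := hL x y
    have h₁ := hsum 1
    linarith
  · have h := mul_le_mul_of_nonneg_left (hsum L⁻¹) hL0
    have h' : L * ((2 * L⁻¹ - L * L⁻¹ ^ 2) * ‖G x - G y‖ ^ 2) = ‖G x - G y‖ ^ 2 := by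
      field_simp
      ring
    linarith

/-- A gradient step of length `2 / (L + 2 * μ)` on `f + μ / 2 * ‖·‖ ^ 2` is a contraction. -/
theorem ConvexOn.norm_gradient_step_le {f : E → ℝ} {G : E → E} {L μ : ℝ} (hL0 : 0 ≤ L) (hμ : 0 < μ)
    (hc : ConvexOn ℝ Set.univ f) (hf : ∀ x, HasGradientAt f (G x) x)
    (hL : ∀ x y, ⟪G x - G y, x - y⟫ ≤ L * ‖x - y‖ ^ 2) (x y : E) :
    ‖(x - y) - (2 / (L + 2 * μ)) • ((G x - G y) + μ • (x - y))‖ ≤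
      L / (L + 2 * μ) * ‖x - y‖ := by
  have hcoc := hc.norm_gradient_sub_sq_le hL0 hf hL x y
  set u := x - y
  set v := G x - G y
  have hpos : 0 < L + 2 * μ := by linarith
  have heq : u - (2 / (L + 2 * μ)) • (v + μ • u) = (L + 2 * μ)⁻¹ • (L • u - (2 : ℝ) • v) := by
    match_scalars <;> field_simp <;> ring
  rw [heq, norm_smul, Real.norm_of_nonneg (inv_nonneg.2 hpos.le), div_mul_eq_mul_div,
    div_eq_inv_mul]
  gcongr
  apply le_of_sq_le_sq _ (by positivity)
  rw [norm_sub_sq_real, norm_smul, norm_smul, inner_smul_left, inner_smul_right,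
    real_inner_comm, Real.norm_of_nonneg hL0]
  simp only [Real.norm_ofNat, conj_trivial]
  nlinarith

theorem StrongConvexOn.mul_norm_sq_le_inner_gradient {f : E → ℝ} {G : E → E} {μ : ℝ}
    (hc : StrongConvexOn Set.univ μ f) (hf : ∀ x, HasGradientAt f (G x) x) (x y : E) :
    μ * ‖x - y‖ ^ 2 ≤ ⟪G x - G y, x - y⟫ := by
  have h := hc.convexOn_sub_sq.inner_gradient_sub_nonneg
    (fun z => (hf z).sub_half_mul_norm_sub_sq μ 0) x y
  rw [show G x - μ • (x - 0) - (G y - μ • (y - 0)) = (G x - G y) - μ • (x - y) by module,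
    inner_sub_left, inner_smul_left, real_inner_self_eq_norm_sq, conj_trivial] at h
  linarith

theorem StrongConvexOn.norm_gradient_step_le {f : E → ℝ} {G : E → E} {L μ : ℝ} (hμ : 0 < μ)
    (hμL : μ ≤ L) (hc : StrongConvexOn Set.univ μ f) (hf : ∀ x, HasGradientAt f (G x) x)
    (hL : ∀ x y, ‖G x - G y‖ ≤ L * ‖x - y‖) (x y : E) :
    ‖(x - y) - (2 / (μ + L)) • (G x - G y)‖ ≤ (L - μ) / (μ + L) * ‖x - y‖ := by
  have hL' : ∀ x y, ⟪G x - μ • (x - 0) - (G y - μ • (y - 0)), x - y⟫ ≤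
      (L - μ) * ‖x - y‖ ^ 2 := by
    intro x y
    rw [show G x - μ • (x - 0) - (G y - μ • (y - 0)) = (G x - G y) - μ • (x - y) by module,
      inner_sub_left, inner_smul_left, real_inner_self_eq_norm_sq, conj_trivial]
    have h := (real_inner_le_norm (G x - G y) (x - y)).trans
      (mul_le_mul_of_nonneg_right (hL x y) (norm_nonneg _))
    linarith
  have h := hc.convexOn_sub_sq.norm_gradient_step_le (sub_nonneg.2 hμL) hμ
    (fun z => (hf z).sub_half_mul_norm_sub_sq μ 0) hL' x y
  rwa [show L - μ + 2 * μ = μ + L by ring,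
    show G x - μ • (x - 0) - (G y - μ • (y - 0)) + μ • (x - y) = G x - G y by module] at h

theorem IsMaxOn.inner_gradient_le_zero {f : E → ℝ} {f' p u : E} {S : Set E} (hS : Convex ℝ S)
    (hp : p ∈ S) (hmax : IsMaxOn f S p) (hf : HasGradientAt f f' p) (hu : u ∈ S) :
    ⟪f', u - p⟫ ≤ 0 := by
  have h := hmax.localize.hasFDerivWithinAt_nonpos
    (hasGradientAt_iff_hasFDerivAt.1 hf).hasFDerivWithinAt
    (sub_mem_posTangentConeAt_of_segment_subset (hS.segment_subset hp hu))
  simpa using h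

theorem inner_sub_le_zero_of_norm_sub_le {S : Set E} (hS : Convex ℝ S) {z p u : E} (hp : p ∈ S)
    (hmin : ∀ w ∈ S, ‖z - p‖ ≤ ‖z - w‖) (hu : u ∈ S) : ⟪z - p, u - p⟫ ≤ 0 := by
  have hmax : IsMaxOn (fun w => (0 : ℝ) - 1 / 2 * ‖w - z‖ ^ 2) S p := by
    intro w hw
    have h := hmin w hw
    rw [norm_sub_rev z, norm_sub_rev z] at h
    have : ‖p - z‖ ^ 2 ≤ ‖w - z‖ ^ 2 := by gcongr
    simpa using this
  have h := hmax.inner_gradient_le_zero hS hp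
    ((hasGradientAt_const p (0 : ℝ)).sub_half_mul_norm_sub_sq 1 z) hu
  simpa using h

end ConvexAnalysis

section Recursions

theorem one_sub_mul_sum_le {ρ : ℝ} {u w : ℕ → ℝ} (hρ : 0 ≤ ρ) (hu : ∀ k, 0 ≤ u k)
    (h : ∀ k, u (k + 1) ≤ ρ * u k + w k) (K : ℕ) :
    (1 - ρ) * ∑ k ∈ Finset.range (K + 1), u k ≤ u 0 + ∑ k ∈ Finset.range K, w k := by
  have key : (1 - ρ) * ∑ k ∈ Finset.range K, u k + u K ≤ u 0 + ∑ k ∈ Finset.range K, w k := by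
    induction K with
    | zero => simp
    | succ K ih =>
      rw [Finset.sum_range_succ, Finset.sum_range_succ]
      linarith [h K]
  rw [Finset.sum_range_succ]
  linarith [mul_nonneg hρ (hu K)]

/-- Discrete Young inequality for the convolution with a geometric sequence. -/
theorem one_sub_sq_mul_sum_sq_le {ρ : ℝ} {u w : ℕ → ℝ} (hρ : 0 ≤ ρ) (hρ1 : ρ < 1)
    (hu : ∀ k, 0 ≤ u k) (hu0 : u 0 = 0) (h : ∀ k, u (k + 1) ≤ ρ * u k + w k) (K : ℕ) :
    (1 - ρ) ^ 2 * ∑ k ∈ Finset.range (K + 1), u k ^ 2 ≤ ∑ k ∈ Finset.range K, w k ^ 2 := by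
  have hρ' : 0 < 1 - ρ := by linarith
  have hrec : ∀ k, u (k + 1) ^ 2 ≤ ρ * u k ^ 2 + w k ^ 2 / (1 - ρ) := by
    intro k
    have h₁ : u (k + 1) ^ 2 ≤ (ρ * u k + w k) ^ 2 := pow_le_pow_left₀ (hu _) (h k) 2
    refine h₁.trans ?_
    rw [← sub_nonneg]
    have : ρ * u k ^ 2 + w k ^ 2 / (1 - ρ) - (ρ * u k + w k) ^ 2 =
        ρ / (1 - ρ) * ((1 - ρ) * u k - w k) ^ 2 := by
      field_simp
      ring
    rw [this]
    positivity
  have hsum := one_sub_mul_sum_le hρ (fun k => sq_nonneg (u k)) hrec K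
  rw [hu0, ← Finset.sum_div] at hsum
  have := mul_le_mul_of_nonneg_left hsum hρ'.le
  calc (1 - ρ) ^ 2 * ∑ k ∈ Finset.range (K + 1), u k ^ 2
      = (1 - ρ) * ((1 - ρ) * ∑ k ∈ Finset.range (K + 1), u k ^ 2) := by ring
    _ ≤ _ := this
    _ = _ := by field_simp; ring

theorem sum_mul_le_of_sum_sq_le {u t : ℕ → ℝ} {C : ℝ} (hC : 0 ≤ C) (s : Finset ℕ)
    (h : ∑ k ∈ s, u k ^ 2 ≤ C ^ 2 * ∑ k ∈ s, t k ^ 2) :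
    ∑ k ∈ s, u k * t k ≤ C * ∑ k ∈ s, t k ^ 2 := by
  have ht : 0 ≤ ∑ k ∈ s, t k ^ 2 := Finset.sum_nonneg fun _ _ => sq_nonneg _
  apply le_of_sq_le_sq _ (by positivity)
  calc (∑ k ∈ s, u k * t k) ^ 2 ≤ (∑ k ∈ s, u k ^ 2) * ∑ k ∈ s, t k ^ 2 :=
        Finset.sum_mul_sq_le_sq_mul_sq _ _ _
    _ ≤ (C ^ 2 * ∑ k ∈ s, t k ^ 2) * ∑ k ∈ s, t k ^ 2 := by gcongr
    _ = _ := by ring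

/-- The sequence with `u 0 = u₀` and `u (k + 1) = ρ * u k + w k`. -/
def affineRec (ρ u₀ : ℝ) (w : ℕ → ℝ) : ℕ → ℝ
  | 0 => u₀
  | k + 1 => ρ * affineRec ρ u₀ w k + w k

theorem affineRec_nonneg {ρ u₀ : ℝ} {w : ℕ → ℝ} (hρ : 0 ≤ ρ) (hu₀ : 0 ≤ u₀) (hw : ∀ k, 0 ≤ w k)
    (k : ℕ) : 0 ≤ affineRec ρ u₀ w k := by
  induction k with
  | zero => exact hu₀
  | succ k ih => exact add_nonneg (mul_nonneg hρ ih) (hw k)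

theorem sum_affineRec_zero_sq_le {ρ C : ℝ} {w t : ℕ → ℝ} (hρ : 0 ≤ ρ) (hρ1 : ρ < 1)
    (hw : ∀ k, 0 ≤ w k) (K : ℕ)
    (h : ∑ k ∈ Finset.range K, w k ^ 2 ≤ C ^ 2 * ∑ k ∈ Finset.range K, t k ^ 2) :
    ∑ k ∈ Finset.range (K + 1), affineRec ρ 0 w k ^ 2 ≤
      (C / (1 - ρ)) ^ 2 * ∑ k ∈ Finset.range K, t k ^ 2 := by
  have hρ' : 0 < 1 - ρ := by linarith
  have := (one_sub_sq_mul_sum_sq_le hρ hρ1 (affineRec_nonneg hρ le_rfl hw) rfl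
    (fun k => le_rfl) K).trans h
  rw [div_pow, div_mul_eq_mul_div, le_div_iff₀' (by positivity)]
  exact this

theorem sum_mul_le_of_coupled_recursion {ρ β a b κ D : ℝ} {δ r t : ℕ → ℝ}
    (hρ : 0 ≤ ρ) (hρ1 : ρ < 1) (hβ : 0 ≤ β) (hβ1 : β < 1) (ha : 0 ≤ a) (hb : 0 ≤ b) (hκ : 0 ≤ κ)
    (hδ0 : 0 ≤ δ 0) (hr0 : 0 ≤ r 0) (ht : ∀ k, 0 ≤ t k) (htD : ∀ k, t k ≤ D)
    (hr : ∀ k, r (k + 1) ≤ β * (r k + b * t k))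
    (hδ : ∀ k, δ (k + 1) ≤ ρ * (δ k + a * t k) + κ * r (k + 1)) (K : ℕ) :
    ∑ k ∈ Finset.range K, δ k * t k ≤
      (δ 0 * D / (1 - ρ) + κ * β * D * r 0 / ((1 - ρ) * (1 - β))) +
        (a * ρ / (1 - ρ) + κ * β * b / ((1 - β) * (1 - ρ))) *
          ∑ k ∈ Finset.range K, t k ^ 2 := by
  have hρ' : 0 < 1 - ρ := by linarith
  have hβ' : 0 < 1 - β := by linarith
  have hD : 0 ≤ D := (ht 0).trans (htD 0)
  set p := affineRec β (r 0) (fun _ => 0) with hp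
  set q := affineRec β 0 (fun k => β * b * t k) with hq
  set H := affineRec ρ (δ 0) (fun k => κ * p (k + 1)) with hH
  set U := affineRec ρ 0 (fun k => ρ * a * t k) with hU
  set V := affineRec ρ 0 (fun k => κ * q (k + 1)) with hV
  have hp0 : ∀ k, 0 ≤ p k := affineRec_nonneg hβ hr0 fun _ => le_rfl
  have hq0 : ∀ k, 0 ≤ q k := affineRec_nonneg hβ le_rfl fun k => by have := ht k; positivity
  have hH0 : ∀ k, 0 ≤ H k := affineRec_nonneg hρ hδ0 fun k => mul_nonneg hκ (hp0 _)
  have hrpq : ∀ k, r k ≤ p k + q k := by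
    intro k
    induction k with
    | zero => simp [hp, hq, affineRec]
    | succ k ih =>
      have h₁ : p (k + 1) = β * p k + 0 := rfl
      have h₂ : q (k + 1) = β * q k + β * b * t k := rfl
      linarith [hr k, mul_le_mul_of_nonneg_left ih hβ]
  have hδHUV : ∀ k, δ k ≤ H k + U k + V k := by
    intro k
    induction k with
    | zero => simp [hH, hU, hV, affineRec]
    | succ k ih =>
      have h₁ : H (k + 1) = ρ * H k + κ * p (k + 1) := rfl
      have h₂ : U (k + 1) = ρ * U k + ρ * a * t k := rfl
      have h₃ : V (k + 1) = ρ * V k + κ * q (k + 1) := rfl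
      linarith [hδ k, mul_le_mul_of_nonneg_left ih hρ,
        mul_le_mul_of_nonneg_left (hrpq (k + 1)) hκ]
  have hinit : ∀ {f : ℕ → ℝ}, (∀ k, 0 ≤ f k) →
      ∑ k ∈ Finset.range K, f k ≤ ∑ k ∈ Finset.range (K + 1), f k := by
    intro f hf
    rw [Finset.sum_range_succ]
    linarith [hf K]
  have hsumH : ∑ k ∈ Finset.range K, H k ≤ (δ 0 + κ * (β * r 0 / (1 - β))) / (1 - ρ) := by
    have h₁ := one_sub_mul_sum_le (w := fun _ => 0) hβ (fun k => hp0 (k + 1))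
      (fun k => le_rfl) K
    have h₂ := one_sub_mul_sum_le hρ hH0 (fun k => le_rfl) K
    have h₃ : p (0 + 1) = β * r 0 := by simp [hp, affineRec]
    have h₄ := hinit fun k => hp0 (k + 1)
    have h₅ : ∑ k ∈ Finset.range K, p (k + 1) ≤ β * r 0 / (1 - β) := by
      rw [le_div_iff₀' hβ']
      rw [h₃, Finset.sum_const_zero, add_zero] at h₁
      exact (mul_le_mul_of_nonneg_left h₄ hβ'.le).trans h₁
    rw [le_div_iff₀' hρ']
    rw [← Finset.mul_sum] at h₂
    have h₆ : H 0 = δ 0 := rfl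
    have h₇ := mul_le_mul_of_nonneg_left (hinit hH0) hρ'.le
    linarith [mul_le_mul_of_nonneg_left h₅ hκ]
  have hconst : ∀ c : ℝ, ∑ k ∈ Finset.range K, (c * t k) ^ 2 ≤
      c ^ 2 * ∑ k ∈ Finset.range K, t k ^ 2 := by
    intro c
    simp_rw [mul_pow, ← Finset.mul_sum]
    exact le_rfl
  have hsumU : ∑ k ∈ Finset.range K, U k * t k ≤
      ρ * a / (1 - ρ) * ∑ k ∈ Finset.range K, t k ^ 2 := by
    apply sum_mul_le_of_sum_sq_le (by positivity)
    exact (hinit fun k => sq_nonneg _).trans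
      (sum_affineRec_zero_sq_le hρ hρ1 (fun k => by have := ht k; positivity) K (hconst _))
  have hsumq : ∑ k ∈ Finset.range K, (κ * q (k + 1)) ^ 2 ≤
      (κ * (β * b / (1 - β))) ^ 2 * ∑ k ∈ Finset.range K, t k ^ 2 := by
    have h := sum_affineRec_zero_sq_le hβ hβ1 (fun k => by have := ht k; positivity) K
      (hconst (β * b))
    rw [Finset.sum_range_succ'] at h
    simp_rw [mul_pow κ, ← Finset.mul_sum, mul_assoc]
    gcongr
    linarith [sq_nonneg (affineRec β 0 (fun k => β * b * t k) 0)]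
  have hsumV : ∑ k ∈ Finset.range K, V k * t k ≤
      κ * (β * b / (1 - β)) / (1 - ρ) * ∑ k ∈ Finset.range K, t k ^ 2 := by
    apply sum_mul_le_of_sum_sq_le (by positivity)
    exact (hinit fun k => sq_nonneg _).trans
      (sum_affineRec_zero_sq_le hρ hρ1 (fun k => mul_nonneg hκ (hq0 _)) K hsumq)
  calc ∑ k ∈ Finset.range K, δ k * t k
      ≤ ∑ k ∈ Finset.range K, (H k * D + U k * t k + V k * t k) := by
        refine Finset.sum_le_sum fun k _ => ?_
        linarith [mul_le_mul_of_nonneg_right (hδHUV k) (ht k),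
          mul_le_mul_of_nonneg_left (htD k) (hH0 k)]
    _ = (∑ k ∈ Finset.range K, H k) * D + ∑ k ∈ Finset.range K, U k * t k +
          ∑ k ∈ Finset.range K, V k * t k := by
        rw [Finset.sum_add_distrib, Finset.sum_add_distrib, Finset.sum_mul]
    _ ≤ (δ 0 + κ * (β * r 0 / (1 - β))) / (1 - ρ) * D +
          ρ * a / (1 - ρ) * ∑ k ∈ Finset.range K, t k ^ 2 +
          κ * (β * b / (1 - β)) / (1 - ρ) * ∑ k ∈ Finset.range K, t k ^ 2 := by
        gcongr
    _ = _ := by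
        field_simp
        ring

end Recursions

/-- Lemma 8 (eq. (25)): summed bound
`∑_{k<K} ‖y_k − y*_μ(x_k)‖ ‖s_k − x_k‖ ≤ Γ₁ + Γ₂ ∑_{k<K} ‖s_k − x_k‖²`. -/
theorem dual_tracking_sum {n m d : ℕ}
    (X : Set (En n)) (Y : Set (En d))
    (hXne : X.Nonempty) (hXconv : Convex ℝ X) (hXcomp : IsCompact X)
    (hYne : Y.Nonempty) (hYconv : Convex ℝ Y) (hYcomp : IsCompact Y)
    -- Assumption 1 (part for `∇_yΦ`)
    (Φ : En n → En m → En d → ℝ)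
    (gradyΦ : En n → En m → En d → En d)
    (hΦsmooth : ContDiff ℝ 1 (fun p : En n × En m × En d => Φ p.1 p.2.1 p.2.2))
    (hgrady : ∀ x θ y, HasGradientAt (fun y' => Φ x θ y') (gradyΦ x θ y) y)
    (hconc : ∀ x θ, ConcaveOn ℝ Set.univ (Φ x θ))
    (Lyx Lyθ Lyy : ℝ) (hLyx : 0 ≤ Lyx) (hLyθ : 0 ≤ Lyθ) (hLyy : 0 ≤ Lyy)
    (hLipyΦ : ∀ x x' θ θ' y y',
      ‖gradyΦ x θ y - gradyΦ x' θ' y'‖ ≤ Lyx * ‖x - x'‖ + Lyθ * ‖θ - θ'‖ + Lyy * ‖y - y'‖)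
    -- Assumption 2: the lower-level objective `g`
    (g : En n → En m → ℝ) (gθ : En n → En m → En m)
    (μg Lg Cgθx : ℝ) (hμg : 0 < μg) (hLg : 0 ≤ Lg) (hCgθx : 0 ≤ Cgθx)
    (hg2 : ∀ x ∈ X, ContDiff ℝ 2 (g x))
    (hgsc : ∀ x ∈ X, StrongConvexOn Set.univ μg (g x))
    (hggrad : ∀ x ∈ X, ∀ θ, HasGradientAt (g x) (gθ x θ) θ)
    (hgθLipθ : ∀ x ∈ X, ∀ θ θ', ‖gθ x θ - gθ x θ'‖ ≤ Lg * ‖θ - θ'‖)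
    (hgθLipx : ∀ θ, ∀ x ∈ X, ∀ x' ∈ X, ‖gθ x θ - gθ x' θ‖ ≤ Cgθx * ‖x - x'‖)
    (θstar : En n → En m)
    (hθmin : ∀ x ∈ X, IsMinOn (g x) Set.univ (θstar x))
    (hθgrad : ∀ x ∈ X, gθ x (θstar x) = 0)
    -- parameters and step sizes
    (μ γ σ α : ℝ) (hμ : 0 < μ) (hγ0 : 0 < γ) (hγ1 : γ ≤ 1)
    (hσ : σ = 2 / (Lyy + 2 * μ)) (hα : α = 2 / (μg + Lg))
    -- the nearest-point projection onto `Y`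
    (PY : En d → En d)
    (hPY : ∀ z, PY z ∈ Y ∧ ∀ u ∈ Y, ‖z - PY z‖ ≤ ‖z - u‖)
    -- the iterates
    (x s : ℕ → En n) (θ : ℕ → En m) (y : ℕ → En d)
    (hx0 : x 0 ∈ X) (hs : ∀ k, s k ∈ X) (hy0 : y 0 ∈ Y)
    (hxupd : ∀ k, x (k + 1) = γ • s k + (1 - γ) • x k)
    (hθupd : ∀ k, θ (k + 1) = θ k - α • gθ (x (k + 1)) (θ k))
    (hyupd : ∀ k, y (k + 1) =
      PY (y k + σ • (gradyΦ (x (k + 1)) (θ (k + 1)) (y k) - μ • (y k - y 0))))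
    -- `y*_μ(x)` is the maximizer over `Y` of `L(x,·) − (μ/2)‖· − y_0‖²`
    (ystar : En n → En d)
    (hystar_mem : ∀ x' ∈ X, ystar x' ∈ Y)
    (hystar_max : ∀ x' ∈ X,
      IsMaxOn (fun u : En d => Φ x' (θstar x') u - μ / 2 * ‖u - y 0‖ ^ 2) Y (ystar x'))
    -- the constants
    (ρD β Lθ Lyμ : ℝ)
    (hρD : ρD = Lyy / (Lyy + 2 * μ)) (hβ : β = (Lg - μg) / (Lg + μg))
    (hLθ : Lθ = Cgθx / μg) (hLyμ : Lyμ = Lyx + Lθ * Lyθ)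
    -- the diameter of `X` and the constants `Γ₁`, `Γ₂`
    (DX : ℝ) (hDX : DX = Metric.diam X)
    (Γ1 Γ2 : ℝ)
    (hΓ1 : Γ1 = ‖y 0 - ystar (x 0)‖ * DX / (1 - ρD)
      + σ * Lyθ * β * DX * ‖θ 0 - θstar (x 0)‖ / ((1 - ρD) * (1 - β)))
    (hΓ2 : Γ2 = γ * Lyμ / (μ * (1 - ρD)) + σ * γ * β * Lyθ * Lθ / ((1 - β) * (1 - ρD))) :
    ∀ K : ℕ, 1 ≤ K →
      ∑ k ∈ Finset.range K, ‖y k - ystar (x k)‖ * ‖s k - x k‖ ≤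
        Γ1 + Γ2 * ∑ k ∈ Finset.range K, ‖s k - x k‖ ^ 2 := by
  intro K _
  have hxX : ∀ k, x k ∈ X := by
    intro k
    induction k with
    | zero => exact hx0
    | succ k ih =>
      rw [hxupd k]
      exact hXconv (hs k) ih hγ0.le (sub_nonneg.2 hγ1) (by ring)
  have hxstep : ∀ k, ‖x k - x (k + 1)‖ = γ * ‖s k - x k‖ := by
    intro k
    rw [hxupd k, show x k - (γ • s k + (1 - γ) • x k) = -(γ • (s k - x k)) by module, norm_neg,
      norm_smul, Real.norm_of_nonneg hγ0.le]
  have htD : ∀ k, ‖s k - x k‖ ≤ DX := by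
    intro k
    rw [hDX, ← dist_eq_norm]
    exact Metric.dist_le_diam_of_mem hXcomp.isBounded (hs k) (hxX k)
  have hden : 0 < Lyy + 2 * μ := by linarith
  have hσ0 : 0 ≤ σ := by rw [hσ]; positivity
  have hρ0 : 0 ≤ ρD := by rw [hρD]; positivity
  have hρ1 : ρD < 1 := by rw [hρD, div_lt_one hden]; linarith
  have hσρ : σ * μ = 1 - ρD := by
    rw [hσ, hρD]
    field_simp
    ring
  have hLθ0 : 0 ≤ Lθ := by rw [hLθ]; positivity
  have hLyμ0 : 0 ≤ Lyμ := by rw [hLyμ]; positivity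
  have hθLip : ∀ x₁ ∈ X, ∀ x₂ ∈ X, ‖θstar x₁ - θstar x₂‖ ≤ Lθ * ‖x₁ - x₂‖ := by
    intro x₁ h₁ x₂ h₂
    have h := (hgsc x₁ h₁).mul_norm_sq_le_inner_gradient (hggrad x₁ h₁) (θstar x₁) (θstar x₂)
    rw [hθgrad x₁ h₁, ← hθgrad x₂ h₂] at h
    have h' := mul_norm_le_of_mul_norm_sq_le_inner (hgθLipx _ x₂ h₂ x₁ h₁) h
    rw [hLθ, div_mul_eq_mul_div, le_div_iff₀' hμg, norm_sub_rev x₁ x₂]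
    exact h'
  have hneg : ∀ x₁ θ₁ y₁, HasGradientAt (fun u => -Φ x₁ θ₁ u) (-gradyΦ x₁ θ₁ y₁) y₁ := by
    intro x₁ θ₁ y₁
    rw [hasGradientAt_iff_hasFDerivAt, map_neg]
    exact (hasGradientAt_iff_hasFDerivAt.1 (hgrady x₁ θ₁ y₁)).fun_neg
  have hnegconv : ∀ x₁ θ₁, ConvexOn ℝ Set.univ fun u => -Φ x₁ θ₁ u :=
    fun x₁ θ₁ => (hconc x₁ θ₁).neg
  have hyopt : ∀ x₁ ∈ X, ∀ u ∈ Y,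
      ⟪gradyΦ x₁ (θstar x₁) (ystar x₁) - μ • (ystar x₁ - y 0), u - ystar x₁⟫ ≤ 0 :=
    fun x₁ h₁ u hu => (hystar_max x₁ h₁).inner_gradient_le_zero hYconv (hystar_mem x₁ h₁)
      ((hgrady _ _ _).sub_half_mul_norm_sub_sq μ (y 0)) hu
  have hyLip : ∀ x₁ ∈ X, ∀ x₂ ∈ X, ‖ystar x₁ - ystar x₂‖ ≤ Lyμ / μ * ‖x₁ - x₂‖ := by
    intro x₁ h₁ x₂ h₂
    have hmono := (hnegconv x₁ (θstar x₁)).inner_gradient_sub_nonneg (hneg x₁ (θstar x₁))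
      (ystar x₁) (ystar x₂)
    have ho₁ := hyopt x₁ h₁ _ (hystar_mem x₂ h₂)
    have ho₂ := hyopt x₂ h₂ _ (hystar_mem x₁ h₁)
    have hbound : ‖gradyΦ x₁ (θstar x₁) (ystar x₂) - gradyΦ x₂ (θstar x₂) (ystar x₂)‖ ≤
        Lyμ * ‖x₁ - x₂‖ := by
      have h := hLipyΦ x₁ x₂ (θstar x₁) (θstar x₂) (ystar x₂) (ystar x₂)
      rw [sub_self, norm_zero] at h
      rw [hLyμ]
      linarith [mul_le_mul_of_nonneg_left (hθLip x₁ h₁ x₂ h₂) hLyθ]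
    rw [div_mul_eq_mul_div, le_div_iff₀' hμ]
    refine mul_norm_le_of_mul_norm_sq_le_inner hbound ?_
    rw [← neg_sub (ystar x₁), inner_neg_right] at ho₁
    rw [← real_inner_self_eq_norm_sq]
    simp only [inner_sub_left, inner_sub_right, inner_neg_left, inner_smul_left, conj_trivial]
      at hmono ho₁ ho₂ ⊢
    linarith
  have hystep : ∀ k, ‖y (k + 1) - ystar (x (k + 1))‖ ≤
      ρD * (‖y k - ystar (x k)‖ + γ * Lyμ / μ * ‖s k - x k‖) +
        σ * Lyθ * ‖θ (k + 1) - θstar (x (k + 1))‖ := by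
    intro k
    set x' := x (k + 1)
    have hx' : x' ∈ X := hxX (k + 1)
    set p := ystar x'
    have hpY : p ∈ Y := hystar_mem x' hx'
    set z := y k + σ • (gradyΦ x' (θ (k + 1)) (y k) - μ • (y k - y 0)) with hz
    set w := p + σ • (gradyΦ x' (θstar x') p - μ • (p - y 0)) with hw
    have hproj : ‖y (k + 1) - p‖ ≤ ‖z - w‖ := by
      rw [hyupd k]
      refine norm_sub_le_of_inner_sub_le_zero
        (inner_sub_le_zero_of_norm_sub_le hYconv (hPY z).1 (hPY z).2 hpY) ?_
      rw [hw, add_sub_cancel_left, inner_smul_left, conj_trivial]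
      exact mul_nonpos_of_nonneg_of_nonpos hσ0 (hyopt x' hx' _ (hPY z).1)
    have hLip : ∀ y₁ y₂, ⟪-gradyΦ x' (θstar x') y₁ - -gradyΦ x' (θstar x') y₂, y₁ - y₂⟫ ≤
        Lyy * ‖y₁ - y₂‖ ^ 2 := by
      intro y₁ y₂
      have h := hLipyΦ x' x' (θstar x') (θstar x') y₁ y₂
      simp only [sub_self, norm_zero, mul_zero, zero_add] at h
      calc _ ≤ _ := real_inner_le_norm _ _
        _ ≤ Lyy * ‖y₁ - y₂‖ * ‖y₁ - y₂‖ := by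
          rw [neg_sub_neg, norm_sub_rev (gradyΦ _ _ y₂)]
          gcongr
        _ = _ := by ring
    have hcontr := (hnegconv x' (θstar x')).norm_gradient_step_le hLyy hμ (hneg x' (θstar x'))
      hLip (y k) p
    rw [← hσ, ← hρD] at hcontr
    have hinexact : ‖σ • (gradyΦ x' (θ (k + 1)) (y k) - gradyΦ x' (θstar x') (y k))‖ ≤
        σ * Lyθ * ‖θ (k + 1) - θstar x'‖ := by
      have h := hLipyΦ x' x' (θ (k + 1)) (θstar x') (y k) (y k)
      simp only [sub_self, norm_zero, mul_zero, zero_add, add_zero] at h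
      rw [norm_smul, Real.norm_of_nonneg hσ0, mul_assoc]
      gcongr
    have hzw : z - w = ((y k - p) - σ • ((-gradyΦ x' (θstar x') (y k) -
        -gradyΦ x' (θstar x') p) + μ • (y k - p))) +
        σ • (gradyΦ x' (θ (k + 1)) (y k) - gradyΦ x' (θstar x') (y k)) := by
      rw [hz, hw]
      module
    have hdrift : ‖y k - p‖ ≤ ‖y k - ystar (x k)‖ + γ * Lyμ / μ * ‖s k - x k‖ := by
      have h₁ := norm_sub_le_norm_sub_add_norm_sub (y k) (ystar (x k)) p
      have h₂ := hyLip (x k) (hxX k) x' hx'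
      rw [hxstep k] at h₂
      calc _ ≤ _ := h₁
        _ ≤ ‖y k - ystar (x k)‖ + Lyμ / μ * (γ * ‖s k - x k‖) := by gcongr
        _ = _ := by ring
    calc ‖y (k + 1) - p‖ ≤ ‖z - w‖ := hproj
      _ ≤ ρD * ‖y k - p‖ + σ * Lyθ * ‖θ (k + 1) - θstar x'‖ := by
        rw [hzw]
        exact (norm_add_le _ _).trans (add_le_add hcontr hinexact)
      _ ≤ _ := by gcongr
  have hβ1 : 0 < 1 - β := by
    rw [hβ, sub_pos, div_lt_one (by linarith)]
    linarith
  have hS : 0 ≤ ∑ k ∈ Finset.range K, ‖s k - x k‖ ^ 2 := Finset.sum_nonneg fun _ _ => sq_nonneg _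
  have ha : 0 ≤ γ * Lyμ / μ := by positivity
  have h1ρ : 0 < 1 - ρD := by linarith
  rcases le_or_gt μg Lg with hμL | hμL
  · have hβ0 : 0 ≤ β := by
      rw [hβ]
      exact div_nonneg (by linarith) (by linarith)
    have hθstep : ∀ k, ‖θ (k + 1) - θstar (x (k + 1))‖ ≤
        β * (‖θ k - θstar (x k)‖ + γ * Lθ * ‖s k - x k‖) := by
      intro k
      have hx' := hxX (k + 1)
      have h := (hgsc _ hx').norm_gradient_step_le hμg hμL (hggrad _ hx') (hgθLipθ _ hx') (θ k)
        (θstar (x (k + 1)))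
      rw [hθgrad _ hx', sub_zero, ← hα, add_comm μg Lg, ← hβ, sub_right_comm, ← hθupd k] at h
      refine h.trans (mul_le_mul_of_nonneg_left ?_ hβ0)
      have h₁ := norm_sub_le_norm_sub_add_norm_sub (θ k) (θstar (x k)) (θstar (x (k + 1)))
      have h₂ := hθLip (x k) (hxX k) _ hx'
      rw [hxstep k] at h₂
      linarith
    have hmain := sum_mul_le_of_coupled_recursion (δ := fun k => ‖y k - ystar (x k)‖)
      (r := fun k => ‖θ k - θstar (x k)‖) (t := fun k => ‖s k - x k‖) hρ0 hρ1 hβ0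
      (by linarith) ha (mul_nonneg hγ0.le hLθ0) (mul_nonneg hσ0 hLyθ) (norm_nonneg _)
      (norm_nonneg _) (fun _ => norm_nonneg _) htD hθstep hystep K
    refine hmain.trans ?_
    rw [hΓ1, hΓ2]
    refine add_le_add le_rfl (mul_le_mul_of_nonneg_right (add_le_add ?_ (le_of_eq ?_)) hS)
    · rw [← div_div]
      exact div_le_div_of_nonneg_right (mul_le_of_le_one_right ha hρ1.le) h1ρ.le
    · ring
  · have hr : ∀ k, ‖θ k - θstar (x k)‖ = 0 := by
      intro k
      have h₁ := (hgsc _ hx0).mul_norm_sq_le_inner_gradient (hggrad _ hx0) (θ k) (θstar (x k))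
      have h₂ := mul_norm_le_of_mul_norm_sq_le_inner (hgθLipθ _ hx0 _ _) h₁
      have h₃ := norm_nonneg (θ k - θstar (x k))
      nlinarith
    have hmain := sum_mul_le_of_coupled_recursion (δ := fun k => ‖y k - ystar (x k)‖)
      (r := fun _ => 0) (t := fun k => ‖s k - x k‖) (κ := 0) (b := 0) hρ0 hρ1 le_rfl one_pos
      ha le_rfl le_rfl (norm_nonneg _) le_rfl (fun _ => norm_nonneg _) htD (fun k => by simp)
      (fun k => by simpa [hr (k + 1)] using hystep k) K
    refine hmain.trans ?_
    rw [hΓ1, hΓ2, hr 0]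
    refine add_le_add (le_of_eq (by simp)) (mul_le_mul_of_nonneg_right ?_ hS)
    have hβhalf : -(1 / 2) ≤ β / (1 - β) := by
      rw [le_div_iff₀ hβ1]
      have : -1 ≤ β := by
        rw [hβ, le_div_iff₀ (by linarith)]
        linarith
      linarith
    have hlhs : γ * Lyμ / μ * ρD / (1 - ρD) =
        (γ * Lyμ * ρD / μ) / (1 - ρD) := by ring
    have hrhs : γ * Lyμ / (μ * (1 - ρD)) + σ * γ * β * Lyθ * Lθ / ((1 - β) * (1 - ρD)) =
        (γ * Lyμ / μ + σ * γ * Lyθ * Lθ * (β / (1 - β))) / (1 - ρD) := by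
      field_simp
    have hmul : σ * γ * Lyθ * Lθ * (-(1 / 2)) ≤ σ * γ * Lyθ * Lθ * (β / (1 - β)) :=
      mul_le_mul_of_nonneg_left hβhalf (by positivity)
    have hslack : γ * Lyμ / μ - γ * Lyμ * ρD / μ = σ * γ * Lyμ := by
      rw [← sub_div, ← mul_one_sub, ← hσρ]
      field_simp
    have hle : σ * γ * (Lθ * Lyθ) ≤ σ * γ * Lyμ := by
      gcongr
      linarith
    have hpos : 0 ≤ σ * γ * (Lθ * Lyθ) := by positivity
    rw [hlhs, hrhs]
    simp only [zero_mul, zero_div, add_zero]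
    refine div_le_div_of_nonneg_right ?_ h1ρ.le
    linarith
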